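/- Let R1, R2, C1, C2 be positive real numbers, let Vi, Vo : ℝ → ℂ with Vi twice differentiable and Vo differentiable on [0, ∞), and let s : ℂ. Suppose the Laplace transforms of Vi, Vi', Vi'' and of Vo, Vo' exist at s, each of these functions is of exponential order (M, a) for some M > 0 and a with Re s > a, the zero initial conditions Vi(0) = 0, Vi'(0) = 0, Vo(0) = 0 hold, the behavioral specification (R1 * C2 : ℂ) * Vo'(t) = -((R1 * R2 * C1 * C2 : ℂ) * Vi''(t) + (R2 * C2 + R1 * C1 : ℂ) * Vi'(t) + Vi(t)) holds for all t ≥ 0, and L[Vi](s) ≠ 0 and (R1 * C2 : ℂ) * s ≠ 0. Then L[Vo](s) / L[Vi](s) = -((R1 * C1 * R2 * C2 : ℂ) * s^2 + ((R2 * C2 : ℂ) + (C1 * R1 : ℂ)) * s + 1) / ((R1 * C2 : ℂ) * s) (transfer function of the PID controller). -/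

import Mathlib

open MeasureTheory Set

/-- The Laplace transform of `f : ℝ → ℂ` at `s : ℂ`. -/
noncomputable def laplace (f : ℝ → ℂ) (s : ℂ) : ℂ :=
  ∫ t in Set.Ioi (0 : ℝ), Complex.exp (-(s * t)) * f t

/-- The Laplace transform of `f` exists at `s`. -/
def laplaceExists (f : ℝ → ℂ) (s : ℂ) : Prop :=
  MeasureTheory.IntegrableOn (fun t : ℝ => Complex.exp (-(s * t)) * f t) (Set.Ioi (0 : ℝ))

/-- `f` is of exponential order `(M, a)`. -/
def expOrder (f : ℝ → ℂ) (M a : ℝ) : Prop :=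
  0 < M ∧ ∀ t : ℝ, 0 ≤ t → ‖f t‖ ≤ M * Real.exp (a * t)

/-- A function of exponential order `(M, a)` with `a < re s` is killed at infinity by the
Laplace kernel. -/
theorem tendsto_exp_neg_mul_of_expOrder {f : ℝ → ℂ} {s : ℂ} {M a : ℝ} (ha : a < s.re)
    (hf : expOrder f M a) :
    Filter.Tendsto (fun t : ℝ => Complex.exp (-(s * t)) * f t) Filter.atTop (nhds 0) := by
  have hlim : Filter.Tendsto (fun t : ℝ => M * Real.exp (-((s.re - a) * t)))
      Filter.atTop (nhds 0) := by
    simpa using (Real.tendsto_exp_neg_atTop_nhds_zero.comp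
      (Filter.tendsto_id.const_mul_atTop (sub_pos.2 ha))).const_mul M
  refine squeeze_zero_norm' ?_ hlim
  filter_upwards [Filter.eventually_ge_atTop 0] with t ht
  have hre : (-(s * t)).re = -(s.re * t) := by simp
  calc ‖Complex.exp (-(s * t)) * f t‖ = Real.exp (-(s.re * t)) * ‖f t‖ := by
        rw [norm_mul, Complex.norm_exp, hre]
    _ ≤ Real.exp (-(s.re * t)) * (M * Real.exp (a * t)) := by
        gcongr
        exact hf.2 t ht
    _ = M * Real.exp (-((s.re - a) * t)) := by
        rw [mul_left_comm, ← Real.exp_add]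
        ring_nf

/-- The Laplace transform of a derivative. -/
theorem laplace_deriv {f : ℝ → ℂ} {s : ℂ}
    (hf : ∀ t ∈ Set.Ici (0 : ℝ), DifferentiableAt ℝ f t)
    (hint : laplaceExists f s) (hint' : laplaceExists (deriv f) s)
    (hexp : ∃ M a : ℝ, a < s.re ∧ expOrder f M a) :
    laplace (deriv f) s = s * laplace f s - f 0 := by
  obtain ⟨M, a, ha, hfa⟩ := hexp
  have hderiv : ∀ t ∈ Set.Ici (0 : ℝ),
      HasDerivAt (fun t : ℝ => Complex.exp (-(s * t)) * f t)
        (Complex.exp (-(s * t)) * deriv f t - s * (Complex.exp (-(s * t)) * f t)) t := by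
    intro t ht
    have hlin : HasDerivAt (fun t : ℝ => -(s * (t : ℂ))) (-(s * 1)) t :=
      (Complex.ofRealCLM.hasDerivAt.const_mul s).neg
    exact (hlin.cexp.mul (hf t ht).hasDerivAt).congr_deriv (by ring)
  have hs : IntegrableOn (fun t : ℝ => s * (Complex.exp (-(s * t)) * f t)) (Set.Ioi 0) :=
    Integrable.const_mul hint s
  have key := integral_Ioi_of_hasDerivAt_of_tendsto' hderiv (Integrable.sub hint' hs)
    (tendsto_exp_neg_mul_of_expOrder ha hfa)
  rw [integral_sub hint' hs, integral_const_mul] at key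
  simp only [Complex.ofReal_zero, mul_zero, neg_zero, Complex.exp_zero, one_mul, zero_sub] at key
  unfold laplace
  linear_combination key

/-- Transfer function of the PID controller from its behavioral specification. -/
theorem pid_transfer_function (R1 R2 C1 C2 : ℝ) (Vi Vo : ℝ → ℂ) (s : ℂ)
    (hR1 : 0 < R1) (hR2 : 0 < R2) (hC1 : 0 < C1) (hC2 : 0 < C2)
    (hVi : ∀ t ∈ Set.Ici (0 : ℝ), DifferentiableAt ℝ Vi t)
    (hVi' : ∀ t ∈ Set.Ici (0 : ℝ), DifferentiableAt ℝ (deriv Vi) t)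
    (hVo : ∀ t ∈ Set.Ici (0 : ℝ), DifferentiableAt ℝ Vo t)
    (hlapVi : laplaceExists Vi s) (hlapVi' : laplaceExists (deriv Vi) s)
    (hlapVi'' : laplaceExists (deriv (deriv Vi)) s)
    (hlapVo : laplaceExists Vo s) (hlapVo' : laplaceExists (deriv Vo) s)
    (hexpVi : ∃ M a : ℝ, a < s.re ∧ expOrder Vi M a)
    (hexpVi' : ∃ M a : ℝ, a < s.re ∧ expOrder (deriv Vi) M a)
    (hexpVi'' : ∃ M a : ℝ, a < s.re ∧ expOrder (deriv (deriv Vi)) M a)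
    (hexpVo : ∃ M a : ℝ, a < s.re ∧ expOrder Vo M a)
    (hexpVo' : ∃ M a : ℝ, a < s.re ∧ expOrder (deriv Vo) M a)
    (hVi0 : Vi 0 = 0) (hVi'0 : deriv Vi 0 = 0) (hVo0 : Vo 0 = 0)
    (hspec : ∀ t : ℝ, 0 ≤ t →
      ((R1 * C2 : ℝ) : ℂ) * deriv Vo t =
        -(((R1 * R2 * C1 * C2 : ℝ) : ℂ) * deriv (deriv Vi) t +
          ((R2 * C2 + R1 * C1 : ℝ) : ℂ) * deriv Vi t + Vi t))
    (hVinz : laplace Vi s ≠ 0) (hdenz : ((R1 * C2 : ℝ) : ℂ) * s ≠ 0) :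
    laplace Vo s / laplace Vi s =
      -(((R1 * C1 * R2 * C2 : ℝ) : ℂ) * s ^ 2 +
          (((R2 * C2 : ℝ) : ℂ) + ((C1 * R1 : ℝ) : ℂ)) * s + 1) /
        (((R1 * C2 : ℝ) : ℂ) * s) := by
  have hVoL := laplace_deriv hVo hlapVo hlapVo' hexpVo
  have hViL := laplace_deriv hVi hlapVi hlapVi' hexpVi
  have hViL' := laplace_deriv hVi' hlapVi' hlapVi'' hexpVi'
  have hL : ((R1 * C2 : ℝ) : ℂ) * laplace (deriv Vo) s =
      -(((R1 * R2 * C1 * C2 : ℝ) : ℂ) * laplace (deriv (deriv Vi)) s +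
        ((R2 * C2 + R1 * C1 : ℝ) : ℂ) * laplace (deriv Vi) s + laplace Vi s) := by
    have h2 := Integrable.const_mul hlapVi'' ((R1 * R2 * C1 * C2 : ℝ) : ℂ)
    have h1 := Integrable.const_mul hlapVi' ((R2 * C2 + R1 * C1 : ℝ) : ℂ)
    unfold laplace
    rw [← integral_const_mul, ← integral_const_mul, ← integral_const_mul, ← integral_add h2 h1,
      ← integral_add (Integrable.fun_add h2 h1) hlapVi, ← integral_neg]
    refine setIntegral_congr_fun measurableSet_Ioi fun t ht => ?_
    linear_combination Complex.exp (-(s * t)) * hspec t (le_of_lt ht)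
  rw [hVoL, hViL', hViL, hVi0, hVi'0, hVo0] at hL
  rw [div_eq_div_iff hVinz hdenz]
  push_cast at hL ⊢
  linear_combination hL
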